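/- arXiv:2604.00712 — 2 statements merged into one kernel-verified Lean document; each statement's English description precedes it below -/
import Mathlib

section
/- Let r₀ > 0, ε₀ ∈ (0, r₀/4), τ ∈ (0, ε₀²), a ∈ ℝ with |a| < ε₀/4, and θ ∈ [π, 2π]. Set z := r₀ + ε₀ e^{iθ} ∈ ℂ. Then |z² − r₀² + 2i z a − iτ| ≥ ε₀ r₀ / 4. -/
noncomputable section

/-- lower bound for the Faddeev symbol on the lower semicircle
`z = r₀ + ε₀ e^{iθ}`, `θ ∈ [π, 2π]`. -/
theorem statement8 (r₀ ε₀ τ a θ : ℝ) (hr : 0 < r₀) (hε : ε₀ ∈ Set.Ioo (0 : ℝ) (r₀ / 4))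
    (hτ : τ ∈ Set.Ioo (0 : ℝ) (ε₀ ^ 2)) (ha : |a| < ε₀ / 4)
    (hθ : θ ∈ Set.Icc Real.pi (2 * Real.pi)) :
    ε₀ * r₀ / 4 ≤
      ‖((r₀ : ℂ) + (ε₀ : ℂ) * Complex.exp (Complex.I * (θ : ℂ))) ^ 2 - (r₀ : ℂ) ^ 2 +
          2 * Complex.I * ((r₀ : ℂ) + (ε₀ : ℂ) * Complex.exp (Complex.I * (θ : ℂ))) * (a : ℂ) -
          Complex.I * (τ : ℂ)‖ := by
  obtain ⟨h0, h1⟩ := hε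
  obtain ⟨t0, t1⟩ := hτ
  have hw : ‖Complex.exp (Complex.I * (θ : ℂ))‖ = 1 := by
    rw [mul_comm]; exact Complex.norm_exp_ofReal_mul_I θ
  generalize Complex.exp (Complex.I * (θ : ℂ)) = w at hw ⊢
  have hr' : ‖(r₀ : ℂ)‖ = r₀ := by simp [abs_of_pos hr]
  have he' : ‖(ε₀ : ℂ) * w‖ = ε₀ := by simp [abs_of_pos h0, hw]
  have hz : ‖(r₀ : ℂ) + (ε₀ : ℂ) * w‖ ≤ r₀ + ε₀ := by
    have h := norm_add_le (r₀ : ℂ) ((ε₀ : ℂ) * w)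
    rwa [hr', he'] at h
  have hA : ε₀ * (2 * r₀ - ε₀) ≤ ‖(ε₀ : ℂ) * w * (2 * r₀ + (ε₀ : ℂ) * w)‖ := by
    rw [norm_mul, he']
    have h := norm_sub_le (2 * (r₀ : ℂ) + (ε₀ : ℂ) * w) ((ε₀ : ℂ) * w)
    rw [add_sub_cancel_right, norm_mul, hr', he'] at h
    have h2 : ‖(2 : ℂ)‖ = 2 := by simp
    rw [h2] at h
    exact mul_le_mul_of_nonneg_left (by linarith) h0.le
  have hB : ‖2 * Complex.I * ((r₀ : ℂ) + (ε₀ : ℂ) * w) * (a : ℂ)‖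
      ≤ 2 * (r₀ + ε₀) * (ε₀ / 4) := by
    have : ‖2 * Complex.I * ((r₀ : ℂ) + (ε₀ : ℂ) * w) * (a : ℂ)‖
        = 2 * ‖(r₀ : ℂ) + (ε₀ : ℂ) * w‖ * |a| := by simp
    rw [this]
    gcongr
  have hC : ‖Complex.I * (τ : ℂ)‖ = τ := by simp [abs_of_pos t0]
  have hE : (ε₀ : ℂ) * w * (2 * r₀ + (ε₀ : ℂ) * w) =
      (((r₀ : ℂ) + (ε₀ : ℂ) * w) ^ 2 - (r₀ : ℂ) ^ 2 +
        2 * Complex.I * ((r₀ : ℂ) + (ε₀ : ℂ) * w) * (a : ℂ) - Complex.I * (τ : ℂ))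
      - 2 * Complex.I * ((r₀ : ℂ) + (ε₀ : ℂ) * w) * (a : ℂ) + Complex.I * (τ : ℂ) := by
    ring
  rw [hE] at hA
  have hT := hA.trans ((norm_add_le _ _).trans (add_le_add_left (norm_sub_le _ _) _))
  rw [hC] at hT
  nlinarith [mul_pos h0 hr, mul_pos h0 (sub_pos.2 h1)]
end
end

section
/- Let r₀ > 0 and τ > 0. Define g : ℝ → ℝ by g(x) := x² − ( ((r₀² − x²)² + τ²)^{1/2} − (r₀² − x²) ) / 2. Then g is strictly increasing on the interval [0, r₀] and g(0) < 0; in particular, g has at most one zero in [0, r₀]. -/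
noncomputable section

/-- the function `g(x) = x² − (√((r₀²−x²)² + τ²) − (r₀²−x²))/2` is strictly
increasing on `[0, r₀]`, negative at `0`, and hence has at most one zero in `[0, r₀]`. -/
theorem statement11 (r₀ τ : ℝ) (hr : 0 < r₀) (hτ : 0 < τ) :
    StrictMonoOn
        (fun x : ℝ => x ^ 2 -
          (Real.sqrt ((r₀ ^ 2 - x ^ 2) ^ 2 + τ ^ 2) - (r₀ ^ 2 - x ^ 2)) / 2)
        (Set.Icc 0 r₀) ∧
    ((0 : ℝ) ^ 2 -
        (Real.sqrt ((r₀ ^ 2 - (0 : ℝ) ^ 2) ^ 2 + τ ^ 2) - (r₀ ^ 2 - (0 : ℝ) ^ 2)) / 2 < 0) ∧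
    ∀ x ∈ Set.Icc (0 : ℝ) r₀, ∀ y ∈ Set.Icc (0 : ℝ) r₀,
      x ^ 2 - (Real.sqrt ((r₀ ^ 2 - x ^ 2) ^ 2 + τ ^ 2) - (r₀ ^ 2 - x ^ 2)) / 2 = 0 →
      y ^ 2 - (Real.sqrt ((r₀ ^ 2 - y ^ 2) ^ 2 + τ ^ 2) - (r₀ ^ 2 - y ^ 2)) / 2 = 0 →
      x = y := by
  have hmono : StrictMonoOn
        (fun x : ℝ => x ^ 2 -
          (Real.sqrt ((r₀ ^ 2 - x ^ 2) ^ 2 + τ ^ 2) - (r₀ ^ 2 - x ^ 2)) / 2)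
        (Set.Icc 0 r₀) := by
    rintro x ⟨hx0, hxr⟩ y ⟨hy0, hyr⟩ hxy
    have h1 : x ^ 2 < y ^ 2 := by gcongr
    have h2 : y ^ 2 ≤ r₀ ^ 2 := by gcongr
    have h3 : (r₀ ^ 2 - y ^ 2) ^ 2 ≤ (r₀ ^ 2 - x ^ 2) ^ 2 :=
      pow_le_pow_left₀ (by linarith) (by linarith) 2
    have h4 : Real.sqrt ((r₀ ^ 2 - y ^ 2) ^ 2 + τ ^ 2)
        ≤ Real.sqrt ((r₀ ^ 2 - x ^ 2) ^ 2 + τ ^ 2) :=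
      Real.sqrt_le_sqrt (by linarith)
    simp only
    linarith
  refine ⟨hmono, ?_, ?_⟩
  · have h : r₀ ^ 2 - (0 : ℝ) ^ 2 < Real.sqrt ((r₀ ^ 2 - (0 : ℝ) ^ 2) ^ 2 + τ ^ 2) := by
      apply Real.lt_sqrt_of_sq_lt
      have : 0 < τ ^ 2 := by positivity
      linarith
    have h0 : (0 : ℝ) ^ 2 = 0 := by norm_num
    rw [h0] at h ⊢
    linarith
  · intro x hx y hy h1 h2
    exact hmono.injOn hx hy (h1.trans h2.symm)
end
end
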